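/- arXiv:1907.01777 — 2 statements merged into one kernel-verified Lean document; each statement's English description precedes it below -/
import Mathlib

section
/- Let k be a field and let A be an associative unital k-algebra generated by a finite-dimensional k-subspace V with 1 ∈ V. For n ≥ 1 let F(n) = dim_k V^n, where V^n denotes the span of all products of at most n factors from V, and set F(0) = 1. Then F is asymptotically equivalent to a constant function, or to the function n ↦ n+1, or to a weakly increasing function G : ℕ → ℕ such that G(n) − G(n−1) ≥ n + 1 for all n ≥ 1 (and G(0) ≥ 1), and G(m) − G(m−1) ≤ (G(n) − G(n−1))^2 for all n ≥ 1 and all m with n ≤ m ≤ 2n. -/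
/-- f ∼ g: asymptotic equivalence of growth functions. -/
def AsympEquiv (f g : ℕ → ℕ) : Prop :=
  (∃ C : ℕ, 0 < C ∧ ∀ n : ℕ, 1 ≤ n → f n ≤ g (C * n)) ∧
  (∃ C : ℕ, 0 < C ∧ ∀ n : ℕ, 1 ≤ n → g n ≤ f (C * n))

/-- The largest function below `H` starting at `H 0` whose increments `g` satisfy
`g m ≤ g n ^ 2` for `n < m ≤ 2 * n`, built greedily. -/
noncomputable def greedyMinorant (H : ℕ → ℕ) : ℕ → ℕ
  | 0 => H 0
  | n + 1 => sInf ({H (n + 1)} ∪ {x | ∃ i, ∃ _ : 1 ≤ i, ∃ _ : i ≤ n, n + 1 ≤ 2 * i ∧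
      x = greedyMinorant H n + (greedyMinorant H i - greedyMinorant H (i - 1)) ^ 2})
termination_by n => n

namespace greedyMinorant

variable {H : ℕ → ℕ}

theorem zero : greedyMinorant H 0 = H 0 := by rw [greedyMinorant]

theorem le (n : ℕ) : greedyMinorant H n ≤ H n := by
  cases n with
  | zero => exact zero.le
  | succ n =>
    rw [greedyMinorant]
    exact Nat.sInf_le (Or.inl rfl)

theorem succ_le {n i : ℕ} (h1 : 1 ≤ i) (h2 : i ≤ n) (h3 : n + 1 ≤ 2 * i) :
    greedyMinorant H (n + 1) ≤
      greedyMinorant H n + (greedyMinorant H i - greedyMinorant H (i - 1)) ^ 2 := by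
  conv_lhs => rw [greedyMinorant]
  exact Nat.sInf_le (Or.inr ⟨i, h1, h2, h3, rfl⟩)

theorem succ_eq (n : ℕ) : greedyMinorant H (n + 1) = H (n + 1) ∨
    ∃ i, 1 ≤ i ∧ i ≤ n ∧ n + 1 ≤ 2 * i ∧ greedyMinorant H (n + 1) =
      greedyMinorant H n + (greedyMinorant H i - greedyMinorant H (i - 1)) ^ 2 := by
  have h := Nat.sInf_mem (s := {H (n + 1)} ∪ {x | ∃ i, ∃ _ : 1 ≤ i, ∃ _ : i ≤ n,
    n + 1 ≤ 2 * i ∧ x = greedyMinorant H n +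
      (greedyMinorant H i - greedyMinorant H (i - 1)) ^ 2}) ⟨_, Or.inl rfl⟩
  rw [← greedyMinorant] at h
  rcases h with h | ⟨i, h1, h2, h3, h4⟩
  · exact Or.inl h
  · exact Or.inr ⟨i, h1, h2, h3, h4⟩

theorem add_le_succ (hH : ∀ n, H n + (n + 2) ≤ H (n + 1)) (n : ℕ) :
    greedyMinorant H n + (n + 2) ≤ greedyMinorant H (n + 1) := by
  induction n using Nat.strong_induction_on with
  | _ n ih =>
    rcases succ_eq (H := H) n with h | ⟨i, h1, h2, h3, h4⟩
    · have := hH n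
      have := le (H := H) n
      omega
    · obtain ⟨i, rfl⟩ : ∃ i', i = i' + 1 := ⟨i - 1, by omega⟩
      have h := ih i (by omega)
      rw [h4]
      simp only [Nat.add_sub_cancel]
      have : i + 2 ≤ greedyMinorant H (i + 1) - greedyMinorant H i := by omega
      have := Nat.pow_le_pow_left this 2
      nlinarith

theorem monotone (hH : ∀ n, H n + (n + 2) ≤ H (n + 1)) : Monotone (greedyMinorant H) :=
  monotone_nat_of_le_succ fun n => by have := add_le_succ hH n; omega

/-- Every increment of the greedy minorant is a repeated square of an increment at a time when
the minorant touches `H`. -/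
theorem exists_touching (n : ℕ) (hn : 1 ≤ n) :
    ∃ i j, 1 ≤ i ∧ i ≤ n ∧ n ≤ 2 ^ j * i ∧ greedyMinorant H i = H i ∧
      (H i - H (i - 1)) ^ 2 ^ j ≤ greedyMinorant H n - greedyMinorant H (n - 1) := by
  induction n using Nat.strong_induction_on with
  | _ n ih =>
    obtain ⟨n, rfl⟩ : ∃ n', n = n' + 1 := ⟨n - 1, by omega⟩
    rcases succ_eq (H := H) n with h | ⟨i, h1, h2, h3, h4⟩
    · refine ⟨n + 1, 0, by omega, le_rfl, by simp, h, ?_⟩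
      have := le (H := H) n
      simp only [pow_zero, pow_one, Nat.add_sub_cancel]
      omega
    · obtain ⟨l, j, hl1, hl2, hl3, hl4, hl5⟩ := ih i (by omega) h1
      refine ⟨l, j + 1, hl1, by omega, ?_, hl4, ?_⟩
      · calc n + 1 ≤ 2 * i := h3
          _ ≤ 2 * (2 ^ j * l) := by gcongr
          _ = _ := by ring
      · rw [h4, Nat.add_sub_cancel, Nat.add_sub_cancel_left, pow_succ, pow_mul]
        exact Nat.pow_le_pow_left hl5 2

theorem le_dilate (hH : ∀ n, H n + (n + 2) ≤ H (n + 1)) {C : ℕ} (hC : 1 ≤ C)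
    (hgrow : ∀ n q j, 1 ≤ n → n ≤ q → C * q ≤ 2 ^ j * n →
      H q ≤ H n + (H n - H (n - 1)) ^ 2 ^ j) (q : ℕ) (hq : 1 ≤ q) :
    H q ≤ greedyMinorant H (C * q) := by
  have hCq : q ≤ C * q := Nat.le_mul_of_pos_left _ hC
  obtain ⟨i, j, h1, h2, h3, h4, h5⟩ := exists_touching (H := H) (C * q) (by omega)
  have hmono := monotone hH
  rcases lt_or_ge i q with h | h
  · have h6 := hgrow i q j h1 h.le h3
    have h7 := hmono (show i ≤ C * q - 1 by omega)
    have h8 := hmono (show C * q - 1 ≤ C * q by omega)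
    omega
  · have hHm : Monotone H := monotone_nat_of_le_succ fun n => by have := hH n; omega
    exact (hHm h).trans (h4.symm.le.trans (hmono h2))

end greedyMinorant

open Finset in
/-- Linear interpolation, rounded down, of `n ↦ ∑ i < 2 * n, f i` between consecutive powers
of two. -/
def dyadicInterpolation (f : ℕ → ℕ) (n : ℕ) : ℕ :=
  ∑ i ∈ range (2 * 2 ^ Nat.log 2 n), f i +
    (n - 2 ^ Nat.log 2 n) * (∑ i ∈ Ico (2 * 2 ^ Nat.log 2 n) (4 * 2 ^ Nat.log 2 n), f i) /
      2 ^ Nat.log 2 n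

namespace dyadicInterpolation

open Finset

variable {f : ℕ → ℕ}

theorem eq_of_mem {N n : ℕ} (k : ℕ) (hN : N = 2 ^ k) (h1 : N ≤ n) (h2 : n ≤ 2 * N) :
    dyadicInterpolation f n = ∑ i ∈ range (2 * N), f i +
      (n - N) * (∑ i ∈ Ico (2 * N) (4 * N), f i) / N := by
  have hNpos : 0 < N := by rw [hN]; positivity
  rcases h2.lt_or_eq with h | rfl
  · have : Nat.log 2 n = k := by
      rw [Nat.log_eq_iff (by right; omega), ← hN, pow_succ, ← hN]
      omega
    rw [dyadicInterpolation, this, ← hN]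
  · have : Nat.log 2 (2 * N) = k + 1 := by
      rw [hN, ← pow_succ', Nat.log_pow (by norm_num)]
    have h2N : 2 ^ (k + 1) = 2 * N := by rw [hN, pow_succ']
    rw [dyadicInterpolation, this, h2N, Nat.sub_self, zero_mul, Nat.zero_div, add_zero,
      show 2 * N - N = N by omega, Nat.mul_div_cancel_left _ hNpos,
      Finset.sum_range_add_sum_Ico _ (by omega), ← mul_assoc]
    norm_num

theorem sum_Ico_div_le_sub {N n : ℕ} (k : ℕ) (hN : N = 2 ^ k) (h1 : N ≤ n) (h2 : n < 2 * N) :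
    dyadicInterpolation f n + (∑ i ∈ Ico (2 * N) (4 * N), f i) / N ≤
      dyadicInterpolation f (n + 1) := by
  rw [eq_of_mem k hN h1 h2.le, eq_of_mem k hN (by omega) h2, add_assoc,
    show n + 1 - N = n - N + 1 by omega, add_mul, one_mul]
  gcongr
  exact Nat.div_add_div_le_add_div

theorem le_sum_range {N n : ℕ} (k : ℕ) (hN : N = 2 ^ k) (h1 : N ≤ n) (h2 : n ≤ 2 * N) :
    dyadicInterpolation f n ≤ ∑ i ∈ range (4 * N), f i := by
  have hNpos : 0 < N := by rw [hN]; positivity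
  rw [eq_of_mem k hN h1 h2, ← Finset.sum_range_add_sum_Ico f (show 2 * N ≤ 4 * N by omega)]
  gcongr
  apply Nat.div_le_of_le_mul
  gcongr
  omega

theorem sum_range_le (n : ℕ) :
    ∑ i ∈ range (n + 1), f i ≤ dyadicInterpolation f n := by
  have := Nat.lt_pow_succ_log_self (b := 2) (by norm_num) n
  rw [pow_succ'] at this
  exact (Finset.sum_le_sum_of_subset (by simpa using this)).trans (Nat.le_add_right _ _)

theorem add_le_succ (hf : ∀ n, 1 ≤ n → n + 1 ≤ f n) {N n : ℕ} (k : ℕ) (hN : N = 2 ^ k)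
    (h1 : N ≤ n) (h2 : n < 2 * N) :
    dyadicInterpolation f n + (4 * N + 2) ≤ dyadicInterpolation f (n + 1) := by
  have hNpos : 0 < N := by rw [hN]; positivity
  refine le_trans ?_ (sum_Ico_div_le_sub k hN h1 h2)
  gcongr
  rw [Nat.le_div_iff_mul_le hNpos]
  calc (4 * N + 2) * N = ∑ i ∈ Ico (2 * N) (4 * N), (2 * N + 1) := by
        rw [sum_const, Nat.card_Ico, smul_eq_mul, show 4 * N - 2 * N = 2 * N by omega]; ring
    _ ≤ _ := Finset.sum_le_sum fun i hi => by
        rw [Finset.mem_Ico] at hi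
        exact le_trans (by omega) (hf i (by omega))

theorem le_pow_div (hsub : ∀ a b, f (a + b) ≤ f a * f b) {M D : ℕ} (hM : 0 < M)
    (hD : ∀ i, M ≤ i → i < 2 * M → f i ≤ D) (i : ℕ) (hi : M ≤ i) : f i ≤ D ^ (i / M) := by
  induction i using Nat.strong_induction_on with
  | _ i ih =>
    rcases lt_or_ge i (2 * M) with h | h
    · rw [Nat.div_eq_of_lt_le (k := 1) (by omega) (by omega), pow_one]
      exact hD i hi h
    · obtain ⟨l, rfl⟩ : ∃ l, i = l + M := ⟨i - M, by omega⟩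
      rw [Nat.add_div_right _ hM, pow_succ]
      exact (hsub l M).trans (Nat.mul_le_mul (ih l (by omega) (by omega))
        (hD M le_rfl (by omega)))

theorem growth (hsub : ∀ a b, f (a + b) ≤ f a * f b) (hf : ∀ n, 1 ≤ n → n + 1 ≤ f n)
    {n q j : ℕ} (hn : 1 ≤ n) (hnq : n ≤ q) (hj : 32 * q ≤ 2 ^ j * n) :
    dyadicInterpolation f (q + 1) ≤ dyadicInterpolation f (n + 1) +
      (dyadicInterpolation f (n + 1) - dyadicInterpolation f n) ^ 2 ^ j := by
  obtain ⟨k, N, hN, h1, h2⟩ : ∃ k N, N = 2 ^ k ∧ N ≤ n ∧ n < 2 * N :=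
    ⟨Nat.log 2 n, _, rfl, Nat.pow_log_le_self 2 (by omega),
      by rw [← pow_succ']; exact Nat.lt_pow_succ_log_self (by norm_num) n⟩
  obtain ⟨l, M, hM, h3, h4⟩ : ∃ k N, N = 2 ^ k ∧ N ≤ q ∧ q < 2 * N :=
    ⟨Nat.log 2 q, _, rfl, Nat.pow_log_le_self 2 (by omega),
      by rw [← pow_succ']; exact Nat.lt_pow_succ_log_self (by norm_num) q⟩
  have hNpos : 0 < N := by rw [hN]; positivity
  set D := ∑ i ∈ Ico (2 * N) (4 * N), f i with hD
  set h := dyadicInterpolation f (n + 1) - dyadicInterpolation f n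
  have hhN : 4 * N + 2 ≤ h := by
    have := add_le_succ hf k hN h1 h2
    omega
  have hDh : D ≤ h ^ 3 := by
    have h5 : D / N ≤ h := by
      have := sum_Ico_div_le_sub (f := f) k hN h1 h2
      rw [← hD] at this
      omega
    have h6 : D < (h + 1) * N := by
      exact (Nat.div_lt_iff_lt_mul hNpos).1 (Nat.lt_succ_of_le h5)
    calc D ≤ (h + 1) * N := h6.le
      _ ≤ (h * h) * h := by gcongr <;> nlinarith
      _ = h ^ 3 := by ring
  have hD1 : 1 ≤ D := by
    have : f (2 * N) ≤ D := Finset.single_le_sum (f := f) (fun _ _ => Nat.zero_le _)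
      (Finset.mem_Ico.2 ⟨le_rfl, by omega⟩)
    have := hf (2 * N) (by omega)
    omega
  obtain ⟨r, hr1, hr2⟩ : ∃ r, q < N * r ∧ N * r ≤ q + N :=
    ⟨q / N + 1, Nat.lt_mul_div_succ q hNpos, by
      rw [mul_add, mul_one]; gcongr; exact Nat.mul_div_le q N⟩
  have hr0 : 1 ≤ r := by
    by_contra hr
    rw [show r = 0 by omega] at hr1
    omega
  have hfi : ∀ i ∈ Ico (2 * N) (4 * q), f i ≤ h ^ (6 * r) := by
    intro i hi
    rw [Finset.mem_Ico] at hi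
    calc f i ≤ D ^ (i / (2 * N)) := le_pow_div hsub (by omega) (fun l hl1 hl2 =>
          Finset.single_le_sum (f := f) (fun _ _ => Nat.zero_le _)
            (Finset.mem_Ico.2 ⟨hl1, by omega⟩)) i hi.1
      _ ≤ D ^ (2 * r) := by
          apply Nat.pow_le_pow_right hD1
          apply Nat.div_le_of_le_mul
          nlinarith
      _ ≤ (h ^ 3) ^ (2 * r) := Nat.pow_le_pow_left hDh _
      _ = h ^ (6 * r) := by rw [← pow_mul]; congr 1; ring
  have hsum : ∑ i ∈ Ico (2 * N) (4 * q), f i ≤ h ^ 2 ^ j := by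
    calc _ ≤ ∑ i ∈ Ico (2 * N) (4 * q), h ^ (6 * r) := Finset.sum_le_sum hfi
      _ ≤ (4 * N * r) * h ^ (6 * r) := by
          rw [sum_const, Nat.card_Ico, smul_eq_mul]
          gcongr
          rw [mul_assoc]
          omega
      _ ≤ (h ^ 1 * h ^ r) * h ^ (6 * r) := by
          gcongr
          · rw [pow_one]
            omega
          · exact (Nat.lt_pow_self (by omega)).le
      _ = h ^ (7 * r + 1) := by rw [← pow_add, ← pow_add]; congr 1; ring
      _ ≤ h ^ 2 ^ j := by
          apply Nat.pow_le_pow_right (by omega)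
          have : 8 * r * N ≤ 2 ^ j * N := by
            have : 2 ^ j * n ≤ 2 ^ j * (2 * N) := by gcongr
            nlinarith
          have := Nat.le_of_mul_le_mul_right this hNpos
          omega
  calc dyadicInterpolation f (q + 1) ≤ ∑ i ∈ range (4 * M), f i :=
        le_sum_range l hM (by omega) (by omega)
    _ ≤ ∑ i ∈ range (4 * q), f i :=
        Finset.sum_le_sum_of_subset (Finset.range_mono (by omega))
    _ = ∑ i ∈ range (2 * N), f i + ∑ i ∈ Ico (2 * N) (4 * q), f i :=
        (Finset.sum_range_add_sum_Ico f (by omega)).symm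
    _ ≤ _ := by
        gcongr
        rw [eq_of_mem k hN (by omega) (by omega)]
        exact Nat.le_add_right _ _

end dyadicInterpolation

open Finset in
/-- A walk with at most as many distinct edges as distinct vertices is periodic, apart from
an initial and a final stretch of bounded length. -/
theorem exists_period_of_card_edges_le {S E : Type*} [DecidableEq S] [DecidableEq E]
    (s : ℕ → S) (e : ℕ → E) (src tgt : E → S) (T B : ℕ)
    (hsrc : ∀ l < T, s l = src (e l)) (htgt : ∀ l < T, s (l + 1) = tgt (e l))
    (hcard : ((range T).image e).card ≤ ((range (T + 1)).image s).card)
    (hB : ((range (T + 1)).image s).card ≤ B) :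
    ∃ p, 1 ≤ p ∧ p ≤ B ∧ ∀ l, B ≤ l → l + B < T → e l = e (l - p) := by
  classical
  set N := (range (T + 1)).filter fun l => ∀ i < l, s i ≠ s l with hN
  set D := (range T).filter fun l => ∀ i < l, e i ≠ e l with hD
  have hmemN : ∀ l, l ∈ N ↔ l ≤ T ∧ ∀ i < l, s i ≠ s l := by simp [hN]
  have hmemD : ∀ l, l ∈ D ↔ l < T ∧ ∀ i < l, e i ≠ e l := by simp [hD]
  have hNinj : Set.InjOn s N := by
    intro a ha b hb hab
    rw [mem_coe, hmemN] at ha hb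
    rcases lt_trichotomy a b with h | h | h
    · exact (hb.2 a h hab).elim
    · exact h
    · exact (ha.2 b h hab.symm).elim
  have hDinj : Set.InjOn e D := by
    intro a ha b hb hab
    rw [mem_coe, hmemD] at ha hb
    rcases lt_trichotomy a b with h | h | h
    · exact (hb.2 a h hab).elim
    · exact h
    · exact (ha.2 b h hab.symm).elim
  have hNim : (range (T + 1)).image s ⊆ N.image s := by
    intro x hx
    obtain ⟨l, hl, rfl⟩ := mem_image.1 hx
    have hex : ∃ i, s i = s l := ⟨l, rfl⟩
    refine mem_image.2 ⟨Nat.find hex, (hmemN _).2 ⟨?_, fun i hi h => ?_⟩, Nat.find_spec hex⟩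
    · have := Nat.find_min' hex rfl
      rw [mem_range] at hl
      omega
    · exact Nat.find_min hex hi (h.trans (Nat.find_spec hex))
  have hNcard : N.card = ((range (T + 1)).image s).card := by
    refine le_antisymm ?_ ((card_le_card hNim).trans card_image_le)
    rw [← card_image_of_injOn hNinj]
    exact card_le_card (image_subset_image (filter_subset _ _))
  have hDcard : D.card ≤ ((range T).image e).card := by
    rw [← card_image_of_injOn hDinj]
    exact card_le_card (image_subset_image (filter_subset _ _))
  have h0N : 0 ∈ N := (hmemN 0).2 ⟨Nat.zero_le _, by simp⟩
  have hNpos : 1 ≤ N.card := card_pos.2 ⟨0, h0N⟩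
  have hstep : ∀ l, l + 1 ∈ N → l ∈ D := by
    intro l hl
    rw [hmemN] at hl
    refine (hmemD l).2 ⟨by omega, fun i hi h => hl.2 (i + 1) (by omega) ?_⟩
    rw [htgt i (by omega), htgt l (by omega), h]
  have hD' : (D.filter fun l => l + 1 ∉ N).card ≤ 1 := by
    have h1 : (N.erase 0).card ≤ (D.filter fun l => l + 1 ∈ N).card := by
      apply card_le_card_of_injOn (fun l => l - 1)
      · intro l hl
        rw [mem_coe, mem_erase] at hl
        obtain ⟨l, rfl⟩ : ∃ l', l = l' + 1 := ⟨l - 1, by omega⟩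
        exact mem_filter.2 ⟨hstep _ hl.2, hl.2⟩
      · intro a ha b hb hab
        rw [mem_coe, mem_erase] at ha hb
        simp only at hab
        omega
    rw [card_erase_of_mem h0N] at h1
    have h2 := card_filter_add_card_filter_not (s := D) (fun l => l + 1 ∈ N)
    omega
  have hnext : ∀ l < T, l ∈ N → l ∈ D := by
    intro l hl hlN
    refine (hmemD l).2 ⟨hl, fun i hi h => ((hmemN l).1 hlN).2 i hi ?_⟩
    rw [hsrc i (by omega), hsrc l hl, h]
  by_cases hall : ∀ l ≤ T, l ∈ N
  · have : T + 1 ≤ N.card := by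
      rw [← card_range (T + 1)]
      exact card_le_card fun l hl => hall l (by rw [mem_range] at hl; omega)
    exact ⟨1, le_rfl, by omega, fun l _ _ => by omega⟩
  push Not at hall
  set j := Nat.find hall with hj
  obtain ⟨hjT, hjN⟩ := Nat.find_spec hall
  have hltj : ∀ l < j, l ∈ N := by
    intro l hl
    by_contra h
    exact Nat.find_min hall hl ⟨by omega, h⟩
  have hj0 : j ≠ 0 := fun h => hjN (by rw [← hj, h]; exact h0N)
  obtain ⟨i, hij, hsij⟩ : ∃ i < j, s i = s j := by
    by_contra! h
    exact hjN ((hmemN _).2 ⟨hjT, h⟩)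
  have honly : ∀ l ∈ D, l + 1 ∉ N → l = j - 1 := by
    intro l hl hlN
    refine card_le_one.1 hD' l (mem_filter.2 ⟨hl, hlN⟩) (j - 1) (mem_filter.2 ⟨?_, ?_⟩)
    · exact hnext _ (by omega) (hltj _ (by omega))
    · rwa [Nat.sub_add_cancel (by omega)]
  have hjB : j ≤ B := by
    rw [← card_range j]
    exact (card_le_card fun l hl => hltj l (mem_range.1 hl)).trans (by omega)
  have hext : ∃ t, j < t ∧ (t ∈ N ∨ t = T + 1) := ⟨T + 1, by omega, Or.inr rfl⟩
  set t := Nat.find hext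
  obtain ⟨hjt, htN⟩ := Nat.find_spec hext
  have htT : t ≤ T + 1 := Nat.find_min' hext ⟨by omega, Or.inr rfl⟩
  have hnotN : ∀ l, j ≤ l → l < t → l ∉ N := by
    intro l hl hlt hlN
    rcases hl.eq_or_lt with h | h
    · exact hjN (by rwa [← hj, h])
    · exact Nat.find_min hext hlt ⟨h, Or.inl hlN⟩
  have hfirst : ∀ a, a + 1 < t → ∃ b < j, e b = e a := by
    intro a ha
    have hex : ∃ b, e b = e a := ⟨a, rfl⟩
    have hle := Nat.find_min' hex rfl
    have hbD : Nat.find hex ∈ D := (hmemD _).2 ⟨by omega, fun i hi h =>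
      Nat.find_min hex hi (h.trans (Nat.find_spec hex))⟩
    refine ⟨Nat.find hex, ?_, Nat.find_spec hex⟩
    by_contra hb
    have := honly _ hbD (hnotN _ (by omega) (by omega))
    omega
  have hdet : ∀ a b, a + 1 < t → b + 1 < t → s a = s b → e a = e b := by
    intro a b ha hb hab
    obtain ⟨a', ha', hea⟩ := hfirst a ha
    obtain ⟨b', hb', heb⟩ := hfirst b hb
    have : a' = b' := by
      apply hNinj (hltj a' ha') (hltj b' hb')
      rw [hsrc a' (by omega), hsrc b' (by omega), hea, heb, ← hsrc a (by omega),
        ← hsrc b (by omega), hab]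
    rw [← hea, ← heb, this]
  have hper : ∀ q, j + q + 1 < t → s (j + q) = s (i + q) ∧ e (j + q) = e (i + q) := by
    intro q
    induction q with
    | zero => exact fun h => ⟨hsij.symm, hdet _ _ (by omega) (by omega) hsij.symm⟩
    | succ q ih =>
      intro h
      have h1 := (ih (by omega)).2
      have h2 : s (j + (q + 1)) = s (i + (q + 1)) := by
        rw [← add_assoc, ← add_assoc, htgt _ (by omega), htgt _ (by omega), h1]
      exact ⟨h2, hdet _ _ (by omega) (by omega) h2⟩
  have htail : ∀ q, t + q ≤ T → t + q ∈ N := by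
    intro q
    induction q with
    | zero =>
      intro h
      exact htN.resolve_right (by omega)
    | succ q ih =>
      intro h
      have h1 := hnext _ (by omega) (ih (by omega))
      by_contra h2
      have := honly _ h1 h2
      omega
  have htB : T + 1 - t ≤ B := by
    have h1 : (Ico t (T + 1)).card ≤ N.card := card_le_card fun l hl => by
      rw [mem_Ico] at hl
      have := htail (l - t) (by omega)
      rwa [Nat.add_sub_cancel' hl.1] at this
    rw [Nat.card_Ico] at h1
    omega
  refine ⟨j - i, by omega, by omega, fun l hl hlT => ?_⟩
  have := (hper (l - j) (by omega)).2
  rwa [show j + (l - j) = l by omega, show i + (l - j) = l - (j - i) by omega] at this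

section FactorialLanguage

variable {α : Type*} {L : Set (List α)}

/-- A long word with at most `n` factors of length `n` is periodic away from its ends. -/
theorem List.exists_period_of_ncard_le [Finite α] (hL : ∀ a u b, a ++ u ++ b ∈ L → u ∈ L) {n : ℕ}
    (hn : {w | w ∈ L ∧ w.length = n}.ncard ≤ n) :
    ∃ K, ∀ w ∈ L, ∃ p, 1 ≤ p ∧ p ≤ K ∧
      ∀ l, K ≤ l → l + K < w.length → w[l]? = w[l - p]? := by
  classical
  obtain ⟨B, hB⟩ : ∃ B, ∀ i ≤ n, {w | w ∈ L ∧ w.length = i}.ncard ≤ B :=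
    ⟨∑ i ∈ Finset.range (n + 1), {w | w ∈ L ∧ w.length = i}.ncard, fun i hi =>
      Finset.single_le_sum (f := fun i => {w | w ∈ L ∧ w.length = i}.ncard)
        (fun _ _ => Nat.zero_le _) (Finset.mem_range.2 (by omega))⟩
  refine ⟨B + n + 1, fun w hw => ?_⟩
  rcases lt_or_ge w.length (B + n + 1) with hshort | hlong
  · exact ⟨1, le_rfl, by omega, fun l _ _ => by omega⟩
  set window : ℕ → ℕ → List α := fun i l => (w.drop l).take i with hwindow
  set c : ℕ → ℕ := fun i =>
    ((Finset.range (w.length - i + 1)).image (window i)).card with hc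
  have hcle : ∀ i ≤ n, c i ≤ {w | w ∈ L ∧ w.length = i}.ncard := by
    intro i hi
    simp only [hc]
    rw [← Set.ncard_coe_finset]
    refine Set.ncard_le_ncard ?_ ((List.finite_length_eq α i).subset fun _ h => h.2)
    intro u hu
    simp only [Finset.coe_image, Set.mem_image, Finset.coe_range, Set.mem_Iio] at hu
    obtain ⟨l, hl, rfl⟩ := hu
    refine ⟨hL (w.take l) _ ((w.drop l).drop i) ?_, ?_⟩
    · rwa [List.append_assoc, List.take_append_drop, List.take_append_drop]
    · simp only [hwindow, List.length_take, List.length_drop]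
      omega
  obtain ⟨i, hin, hi1, hi2⟩ : ∃ i < n, i + 1 ≤ c i ∧ c (i + 1) ≤ i + 1 := by
    by_contra! h
    have : ∀ i ≤ n, i + 1 ≤ c i := by
      intro i
      induction i with
      | zero =>
        intro _
        exact Finset.card_pos.2 ⟨_, Finset.mem_image_of_mem _ (Finset.mem_range.2 (Nat.succ_pos _))⟩
      | succ i ih => exact fun hi => h i (by omega) (ih (by omega))
    have h1 := this n le_rfl
    have h2 := hcle n le_rfl
    omega
  obtain ⟨p, hp1, hp2, hp⟩ := exists_period_of_card_edges_le (window i) (window (i + 1))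
    (fun u => u.take i) (fun u => u.tail) (w.length - i) B
    (fun l _ => by simp [hwindow, List.take_take])
    (fun l _ => by simp [hwindow, List.tail_take_eq_take_tail, List.tail_drop])
    (by
      have : w.length - (i + 1) + 1 = w.length - i := by omega
      simp only [hc, this] at hi1 hi2
      omega)
    ((hcle i hin.le).trans (hB i hin.le))
  refine ⟨p, hp1, by omega, fun l hl hlw => ?_⟩
  have h1 := congrArg (fun u : List α => u[0]?) (hp l (by omega) (by omega))
  simpa [hwindow, List.getElem?_take, List.getElem?_drop] using h1

/-- Bergman's gap theorem for factorial languages. -/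
theorem exists_ncard_length_eq_le [Finite α] (hL : ∀ a u b, a ++ u ++ b ∈ L → u ∈ L) {n : ℕ}
    (hn : {w | w ∈ L ∧ w.length = n}.ncard ≤ n) :
    ∃ B, ∀ m, {w | w ∈ L ∧ w.length = m}.ncard ≤ B := by
  obtain ⟨K, hK⟩ := List.exists_period_of_ncard_le hL hn
  choose! p hp1 hp2 hp using hK
  set S : Set (List α) := {u | u.length ≤ K} with hS
  have hSfin : S.Finite := List.finite_length_le α K
  refine ⟨(Set.Iic K ×ˢ S ×ˢ S).ncard, fun m => ?_⟩
  refine Set.ncard_le_ncard_of_injOn (fun w => (p w, w.take K, w.drop (m - K))) ?_ ?_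
    ((Set.finite_Iic K).prod (hSfin.prod hSfin))
  · rintro w ⟨hw, hwm⟩
    refine ⟨hp2 w hw, ?_, ?_⟩
    · simp [hS]
    · simp only [hS, Set.mem_ofPred_eq, List.length_drop]
      omega
  · rintro w ⟨hw, hwm⟩ w' ⟨hw', hwm'⟩ heq
    simp only [Prod.mk.injEq] at heq
    obtain ⟨h1, h2, h3⟩ := heq
    refine List.ext_getElem? fun l => ?_
    induction l using Nat.strong_induction_on with
    | _ l ih =>
      rcases lt_or_ge l K with hlK | hlK
      · have := congrArg (fun u : List α => u[l]?) h2
        simpa [List.getElem?_take, hlK] using this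
      rcases lt_or_ge (l + K) m with hlm | hlm
      · have := hp1 w hw
        have := hp2 w hw
        rw [hp w hw l hlK (by omega), hp w' hw' l hlK (by omega), ← h1]
        exact ih _ (by omega)
      · have := congrArg (fun u : List α => u[l - (m - K)]?) h3
        simpa [List.getElem?_drop, show m - K + (l - (m - K)) = l by omega] using this

theorem ncard_length_add_le [Finite α] (hL : ∀ a u b, a ++ u ++ b ∈ L → u ∈ L) (m n : ℕ) :
    {w | w ∈ L ∧ w.length = m + n}.ncard ≤
      {w | w ∈ L ∧ w.length = m}.ncard * {w | w ∈ L ∧ w.length = n}.ncard := by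
  have hfin : ∀ i, {w | w ∈ L ∧ w.length = i}.Finite := fun i =>
    (List.finite_length_eq α i).subset fun _ h => h.2
  rw [← Set.ncard_prod]
  refine Set.ncard_le_ncard_of_injOn (fun w => (w.take m, w.drop m)) ?_ ?_
    ((hfin m).prod (hfin n))
  · rintro w ⟨hw, hwm⟩
    refine ⟨⟨hL [] _ (w.drop m) (by simpa using hw), ?_⟩,
      ⟨hL (w.take m) _ [] (by simpa using hw), ?_⟩⟩ <;> simp [hwm]
  · intro w _ w' _ h
    simp only [Prod.mk.injEq] at h
    rw [← List.take_append_drop m w, h.1, h.2, List.take_append_drop]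

end FactorialLanguage

section NormalWords

variable {k A M ι α : Type*} [Field k] [Ring A] [Algebra k A] [AddCommGroup M] [Module k M]

open Submodule Module

open scoped Classical in
/-- Adding the vectors `v i` in increasing order, the dimension grows at each new vector that is
not in the span so far. -/
theorem Submodule.finrank_sup_span_image_eq_add_card [LinearOrder ι] (U : Submodule k M)
    [Module.Finite k U] (v : ι → M) (s : Finset ι) :
    finrank k (U ⊔ span k (v '' s) : Submodule k M) = finrank k U +
      (s.filter fun i => v i ∉ U ⊔ span k (v '' {j | j ∈ s ∧ j < i})).card := by
  induction s using Finset.induction_on_max with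
  | empty =>
    rw [show U ⊔ span k (v '' (∅ : Finset ι)) = U by simp]
    simp
  | insert a s ha ih =>
    have ha' : a ∉ s := fun h => (ha a h).false
    have hset : {j | j ∈ insert a s ∧ j < a} = (s : Set ι) := by
      ext j
      simp only [Finset.mem_insert, Set.mem_ofPred_eq, Finset.mem_coe]
      constructor
      · rintro ⟨rfl | h, h'⟩
        · exact (lt_irrefl _ h').elim
        · exact h
      · exact fun h => ⟨Or.inr h, ha j h⟩
    have hfilter : (s.filter fun i => v i ∉ U ⊔ span k (v '' {j | j ∈ insert a s ∧ j < i})) =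
        s.filter fun i => v i ∉ U ⊔ span k (v '' {j | j ∈ s ∧ j < i}) := by
      refine Finset.filter_congr fun i hi => ?_
      have : {j | j ∈ insert a s ∧ j < i} = {j | j ∈ s ∧ j < i} := by
        ext j
        simp only [Finset.mem_insert, Set.mem_ofPred_eq]
        constructor
        · rintro ⟨rfl | h, h'⟩
          · exact ((ha i hi).trans h').false.elim
          · exact ⟨h, h'⟩
        · exact fun h => ⟨Or.inr h.1, h.2⟩
      rw [this]
    have hspan : U ⊔ span k (v '' (insert a s : Finset ι)) =
        (U ⊔ span k (v '' s)) ⊔ span k {v a} := by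
      rw [Finset.coe_insert, Set.image_insert_eq, span_insert, sup_comm (span k {v a}), sup_assoc]
    have : Module.Finite k (span k (v '' (s : Set ι))) :=
      Module.Finite.span_of_finite k (s.finite_toSet.image v)
    rw [Finset.filter_insert, hset, hfilter, hspan]
    by_cases hmem : v a ∈ U ⊔ span k (v '' s)
    · rw [if_neg (not_not.2 hmem), ← ih,
        sup_eq_left.2 ((span_singleton_le_iff_mem _ _).2 hmem)]
    · rw [if_pos hmem, Finset.card_insert_of_notMem (by simp [ha']), ← add_assoc, ← ih]
      have h := finrank_sup_add_finrank_inf_eq (U ⊔ span k (v '' (s : Set ι))) (span k {v a})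
      have hv : v a ≠ 0 := fun h => hmem (h ▸ zero_mem _)
      rwa [((disjoint_span_singleton' hv).2 hmem).eq_bot, finrank_bot, add_zero,
        finrank_span_singleton hv] at h

/-- The value in `A` of a word in the letters `α`, for the letters interpreted by `x`. -/
def wordEval (x : α → A) (w : List α) : A := (w.map x).prod

/-- The words whose value is not a linear combination of values of words that are smaller in the
shortlex order. -/
def normalWords (k : Type*) [Field k] [Algebra k A] [LT α] (x : α → A) : Set (List α) :=
  {w | wordEval x w ∉ span k (wordEval x '' {u | List.Shortlex (· < ·) u w})}

theorem wordEval_append (x : α → A) (u w : List α) :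
    wordEval x (u ++ w) = wordEval x u * wordEval x w := by
  simp [wordEval]

theorem List.Shortlex.append_right_append_right {r : α → α → Prop} {u w : List α}
    (h : List.Shortlex r u w) (b : List α) : List.Shortlex r (u ++ b) (w ++ b) := by
  rcases List.shortlex_def.1 h with h | ⟨h, h'⟩
  · exact .of_length_lt (by simpa using h)
  · refine .of_lex (by simpa using h) ?_
    clear * - h h'
    induction h' with
    | nil => simp at h
    | cons _ ih => exact .cons (ih (by simpa using h))
    | rel h1 => exact .rel h1

theorem normalWords_infix [LT α] (x : α → A) {a u b : List α}
    (h : a ++ u ++ b ∈ normalWords k x) : u ∈ normalWords k x := by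
  intro hu
  apply h
  rw [wordEval_append, wordEval_append]
  have := Submodule.mem_map_of_mem (f := (LinearMap.mulRight k (wordEval x b)).comp
    (LinearMap.mulLeft k (wordEval x a))) hu
  rw [Submodule.map_span] at this
  refine span_mono ?_ this
  rintro _ ⟨_, ⟨v, hv, rfl⟩, rfl⟩
  refine ⟨a ++ v ++ b, (hv.append_left a).append_right_append_right b, ?_⟩
  simp [wordEval_append, mul_assoc]

theorem span_wordEval_length_eq (x : α → A) (n : ℕ) :
    span k (wordEval x '' {w | w.length = n}) = span k (Set.range x) ^ n := by
  induction n with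
  | zero => simp [wordEval, Submodule.one_eq_span]
  | succ n ih =>
    rw [pow_succ, ← ih, span_mul_span]
    congr 1
    ext a
    constructor
    · rintro ⟨w, hw, rfl⟩
      obtain ⟨w, c, rfl⟩ := (List.eq_nil_or_concat' w).resolve_left (by rintro rfl; simp at hw)
      exact ⟨_, ⟨w, by simpa using hw, rfl⟩, _, ⟨c, rfl⟩, by simp [wordEval]⟩
    · rintro ⟨_, ⟨w, hw, rfl⟩, _, ⟨c, rfl⟩, rfl⟩
      exact ⟨w ++ [c], by simpa using hw, by simp [wordEval]⟩

theorem finrank_span_wordEval_length_lt_succ [LinearOrder α] [Finite α] (x : α → A) (n : ℕ) :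
    finrank k (span k (wordEval x '' {w | w.length < n + 1})) =
      finrank k (span k (wordEval x '' {w | w.length < n})) +
        {w | w ∈ normalWords k x ∧ w.length = n}.ncard := by
  classical
  set s := (List.finite_length_eq α n).toFinset with hs
  have hfin : Module.Finite k (span k (wordEval x '' {w | w.length < n})) :=
    Module.Finite.span_of_finite k ((List.finite_length_lt α n).image _)
  have hcoe : (s : Set (List α)) = {w | w.length = n} := by simp [hs]
  have h1 : span k (wordEval x '' {w | w.length < n + 1}) =
      span k (wordEval x '' {w | w.length < n}) ⊔ span k (wordEval x '' s) := by
    rw [hcoe, ← span_union, ← Set.image_union]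
    congr 2
    ext w
    simp only [Set.mem_ofPred_eq, Set.mem_union]
    omega
  rw [h1, Submodule.finrank_sup_span_image_eq_add_card, ← Set.ncard_coe_finset]
  congr 2
  ext w
  simp only [Finset.coe_filter, Set.mem_ofPred_eq, normalWords]
  rw [and_comm, show w ∈ s ↔ w.length = n by simp [hs]]
  refine and_congr_left fun hw => ?_
  rw [← span_union, ← Set.image_union]
  have : {w | w.length < n} ∪ {j | j ∈ s ∧ j < w} = {u | List.Shortlex (· < ·) u w} := by
    ext u
    simp only [Set.mem_union, Set.mem_ofPred_eq, List.shortlex_def, hw, hs,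
      Set.Finite.mem_toFinset]
    rfl
  rw [this]

theorem finrank_pow_eq_sum_ncard_normalWords [LinearOrder α] [Finite α] (x : α → A)
    (h1 : (1 : A) ∈ span k (Set.range x)) (n : ℕ) :
    finrank k (span k (Set.range x) ^ n : Submodule k A) =
      ∑ i ∈ Finset.range (n + 1), {w | w ∈ normalWords k x ∧ w.length = i}.ncard := by
  have h2 : ∀ n, finrank k (span k (wordEval x '' {w | w.length < n})) =
      ∑ i ∈ Finset.range n, {w | w ∈ normalWords k x ∧ w.length = i}.ncard := by
    intro n
    induction n with
    | zero =>
      have : {w : List α | w.length < 0} = ∅ := by simp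
      rw [this, Set.image_empty, span_empty, finrank_bot, Finset.range_zero, Finset.sum_empty]
    | succ n ih => rw [finrank_span_wordEval_length_lt_succ, ih, Finset.sum_range_succ]
  suffices h : span k (Set.range x) ^ n = span k (wordEval x '' {w | w.length < n + 1}) by
    rw [← h2, h]
  apply le_antisymm
  · rw [← span_wordEval_length_eq]
    exact span_mono (Set.image_mono fun w hw => by
      simp only [Set.mem_ofPred_eq] at hw ⊢; omega)
  · rw [span_le]
    rintro _ ⟨w, hw, rfl⟩
    have h3 : wordEval x w ∈ span k (Set.range x) ^ w.length := by
      rw [← span_wordEval_length_eq]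
      exact subset_span ⟨w, rfl, rfl⟩
    exact pow_le_pow_right₀ (Submodule.one_le.2 h1) (Nat.le_of_lt_succ hw) h3

end NormalWords

open Finset in
/-- The trichotomy for partial sums of a submultiplicative sequence that satisfies
Bergman's gap theorem. -/
theorem sum_range_trichotomy {f : ℕ → ℕ} (hf0 : f 0 = 1)
    (hsub : ∀ a b, f (a + b) ≤ f a * f b) (hgap : ∀ n, f n ≤ n → ∃ B, ∀ m, f m ≤ B) :
    (∃ c : ℕ, AsympEquiv (fun n => ∑ i ∈ range (n + 1), f i) (fun _ => c)) ∨
    (AsympEquiv (fun n => ∑ i ∈ range (n + 1), f i) (fun n => n + 1)) ∨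
    (∃ G : ℕ → ℕ, Monotone G ∧ 1 ≤ G 0 ∧
      (∀ n : ℕ, 1 ≤ n → n + 1 ≤ G n - G (n - 1)) ∧
      (∀ n m : ℕ, 1 ≤ n → n ≤ m → m ≤ 2 * n →
        G m - G (m - 1) ≤ (G n - G (n - 1)) ^ 2) ∧
      AsympEquiv (fun n => ∑ i ∈ range (n + 1), f i) G) := by
  have hmono : Monotone fun n => ∑ i ∈ range n, f i :=
    fun a b hab => sum_le_sum_of_subset (range_mono hab)
  by_cases hsmall : ∃ n, f n ≤ n
  · obtain ⟨n, hn⟩ := hsmall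
    obtain ⟨B, hB⟩ := hgap n hn
    by_cases hzero : ∃ n, f n = 0
    · obtain ⟨N, hN⟩ := hzero
      refine Or.inl ⟨∑ i ∈ range N, f i, ⟨1, one_pos, fun n _ => ?_⟩,
        ⟨N + 1, N.succ_pos, fun n hn => ?_⟩⟩
      · refine (hmono (show n + 1 ≤ N + (n + 1) by omega)).trans ?_
        simp only
        rw [sum_range_add, sum_eq_zero (f := fun i => f (N + i)), add_zero]
        exact fun i _ => Nat.eq_zero_of_le_zero (by simpa [hN] using hsub N i)
      · exact hmono (by nlinarith)
    · refine Or.inr (Or.inl ⟨⟨2 * B + 1, by omega, fun n hn => ?_⟩,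
        ⟨1, one_pos, fun n _ => ?_⟩⟩)
      · have := sum_le_card_nsmul (range (n + 1)) f B fun i _ => hB i
        rw [card_range, smul_eq_mul] at this
        nlinarith
      · have := card_nsmul_le_sum (range (1 * n + 1)) f 1 fun i _ =>
          Nat.one_le_iff_ne_zero.2 fun h => hzero ⟨i, h⟩
        simpa using this
  · push Not at hsmall
    refine Or.inr (Or.inr ?_)
    set H : ℕ → ℕ := fun n => dyadicInterpolation f (n + 1) with hHdef
    have hH : ∀ n, H n + (n + 2) ≤ H (n + 1) := by
      intro n
      have h1 := Nat.pow_log_le_self 2 (show n + 1 ≠ 0 by omega)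
      have h2 := Nat.lt_pow_succ_log_self (b := 2) (by norm_num) (n + 1)
      rw [pow_succ'] at h2
      have := dyadicInterpolation.add_le_succ (fun n _ => hsmall n) _ rfl h1 h2
      simp only [hHdef]
      omega
    refine ⟨greedyMinorant H, greedyMinorant.monotone hH, ?_, ?_, ?_, ⟨32, by norm_num, ?_⟩,
      ⟨4, by norm_num, ?_⟩⟩
    · rw [greedyMinorant.zero]
      refine le_trans ?_ (dyadicInterpolation.sum_range_le _)
      exact (hf0.ge.trans (single_le_sum (f := f) (fun _ _ => Nat.zero_le _) (by simp)))
    · intro n hn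
      have := greedyMinorant.add_le_succ hH (n - 1)
      rw [Nat.sub_add_cancel hn] at this
      omega
    · intro n m hn hnm hmn
      rcases hnm.eq_or_lt with rfl | hlt
      · exact Nat.le_self_pow two_ne_zero _
      · have := greedyMinorant.succ_le (H := H) (n := m - 1) hn (by omega) (by omega)
        rw [Nat.sub_add_cancel (by omega)] at this
        omega
    · intro n hn
      refine le_trans ?_ (greedyMinorant.le_dilate hH (by norm_num) ?_ n hn)
      · exact (hmono (Nat.le_succ _)).trans (dyadicInterpolation.sum_range_le _)
      · intro n q j hn hnq hj
        have := dyadicInterpolation.growth hsub (fun n _ => hsmall n) hn hnq hj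
        simpa only [hHdef, Nat.sub_add_cancel hn] using this
    · intro n hn
      have h1 := Nat.pow_log_le_self 2 (show n ≠ 0 by omega)
      have h2 := Nat.lt_pow_succ_log_self (b := 2) (by norm_num) n
      rw [pow_succ'] at h2
      refine (greedyMinorant.le n).trans
        ((dyadicInterpolation.le_sum_range (N := 2 ^ Nat.log 2 n) _ rfl (by omega)
          (by omega)).trans (hmono ?_))
      omega

theorem AsympEquiv.congr_left {f f' g : ℕ → ℕ} (h : AsympEquiv f g)
    (hff' : ∀ n, 1 ≤ n → f n = f' n) : AsympEquiv f' g := by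
  obtain ⟨⟨C, hC, hC'⟩, ⟨D, hD, hD'⟩⟩ := h
  refine ⟨⟨C, hC, fun n hn => hff' n hn ▸ hC' n hn⟩, ⟨D, hD, fun n hn => ?_⟩⟩
  rw [← hff' (D * n) (Nat.mul_pos hD hn)]
  exact hD' n hn

/-- The growth function of a finitely generated algebra is asymptotically equivalent to a
constant, to n ↦ n + 1, or to a weakly increasing G with G(n) - G(n-1) ≥ n + 1 and
G(m) - G(m-1) ≤ (G(n) - G(n-1))² for n ≥ 1 and n ≤ m ≤ 2n. -/
theorem algebra_growth_trichotomy (k : Type*) [Field k] (A : Type*) [Ring A] [Algebra k A]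
    (V : Submodule k A) (hVfd : FiniteDimensional k V) (h1V : (1 : A) ∈ V)
    (hgen : Algebra.adjoin k (V : Set A) = ⊤)
    (F : ℕ → ℕ) (hF0 : F 0 = 1)
    (hF : ∀ n : ℕ, 1 ≤ n → F n = Module.finrank k (V ^ n : Submodule k A)) :
    (∃ c : ℕ, AsympEquiv F (fun _ => c)) ∨
    (AsympEquiv F (fun n => n + 1)) ∨
    (∃ G : ℕ → ℕ, Monotone G ∧ 1 ≤ G 0 ∧
      (∀ n : ℕ, 1 ≤ n → n + 1 ≤ G n - G (n - 1)) ∧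
      (∀ n m : ℕ, 1 ≤ n → n ≤ m → m ≤ 2 * n →
        G m - G (m - 1) ≤ (G n - G (n - 1)) ^ 2) ∧
      AsympEquiv F G) := by
  rcases subsingleton_or_nontrivial A with hA | hA
  · refine Or.inl ⟨0, ⟨1, one_pos, fun n hn => ?_⟩, ⟨1, one_pos, fun n _ => Nat.zero_le _⟩⟩
    rw [hF n hn, Module.finrank_zero_of_subsingleton]
  set b := Module.finBasis k V
  set x : Fin (Module.finrank k V) → A := fun i => b i
  have hspan : Submodule.span k (Set.range x) = V := by
    have : Set.range x = V.subtype '' Set.range b := by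
      rw [← Set.range_comp]
      rfl
    rw [this, Submodule.span_image, b.span_eq, Submodule.map_top, Submodule.range_subtype]
  have hL : ∀ a u c, a ++ u ++ c ∈ normalWords k x → u ∈ normalWords k x :=
    fun _ _ _ h => normalWords_infix x h
  have hsum : ∀ n, Module.finrank k (V ^ n : Submodule k A) =
      ∑ i ∈ Finset.range (n + 1), {w | w ∈ normalWords k x ∧ w.length = i}.ncard := by
    intro n
    have := finrank_pow_eq_sum_ncard_normalWords (k := k) x (by rwa [hspan]) n
    rwa [hspan] at this
  have hzero : {w | w ∈ normalWords k x ∧ w.length = 0}.ncard = 1 := by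
    have := hsum 0
    rw [pow_zero, Submodule.one_eq_span, finrank_span_singleton one_ne_zero, zero_add,
      Finset.sum_range_one] at this
    exact this.symm
  have hFf : ∀ n, 1 ≤ n →
      ∑ i ∈ Finset.range (n + 1), {w | w ∈ normalWords k x ∧ w.length = i}.ncard = F n :=
    fun n hn => by rw [hF n hn, hsum]
  rcases sum_range_trichotomy (f := fun i => {w | w ∈ normalWords k x ∧ w.length = i}.ncard)
    hzero (ncard_length_add_le hL) (fun n => exists_ncard_length_eq_le hL)
    with ⟨c, h⟩ | h | ⟨G, h1, h2, h3, h4, h⟩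
  · exact Or.inl ⟨c, h.congr_left hFf⟩
  · exact Or.inr (Or.inl (h.congr_left hFf))
  · exact Or.inr (Or.inr ⟨G, h1, h2, h3, h4, h.congr_left hFf⟩)
end

section
/- Let k be a field, let A be an associative unital k-algebra, and let V be a finite-dimensional k-subspace of A with 1 ∈ V that generates A as a k-algebra. For n ≥ 1 let F(n) = dim_k V^n, where V^n is the span of all products of at most n factors from V, set F(0) = 1, and let f(n) = F(n) − F(n−1) for n ≥ 1. Then f(m) ≤ f(n)^2 for all n ≥ 1 and all m with n ≤ m ≤ 2n. -/
section NormalWords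

variable {k A W : Type*} [Field k] [Ring A] [Algebra k A]

/-- An index `w` is normal if the vector `v w` is not a linear combination of vectors with
smaller index. -/
def IsNormalIndex (k : Type*) [Field k] {A W : Type*} [Ring A] [Algebra k A]
    (r : W → W → Prop) (v : W → A) (w : W) : Prop :=
  v w ∉ Submodule.span k (v '' {u | r u w})

theorem linearIndepOn_isNormalIndex (r : W → W → Prop) [IsStrictTotalOrder W r] (v : W → A) :
    LinearIndepOn k v {w | IsNormalIndex k r v w} := by
  classical
  let _ : LinearOrder W := linearOrderOfSTO r
  rw [linearIndepOn_iff_linearIndepOn_finset]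
  intro t
  refine Finset.induction_on_max t (by simp) fun a s hlt ih ht => ?_
  rw [Finset.coe_insert, Set.insert_subset_iff] at ht
  rw [Finset.coe_insert]
  refine (ih ht.2).insert fun hmem => ht.1 ?_
  exact Submodule.span_mono (Set.image_mono fun x hx => hlt x hx) hmem

theorem mem_span_isNormalIndex {r : W → W → Prop} [IsTrans W r] (hr : WellFounded r)
    (v : W → A) (w : W) :
    v w ∈ Submodule.span k (v '' {u | IsNormalIndex k r v u ∧ (u = w ∨ r u w)}) := by
  induction w using hr.induction with
  | h w ih =>
    by_cases hw : IsNormalIndex k r v w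
    · exact Submodule.subset_span ⟨w, ⟨hw, Or.inl rfl⟩, rfl⟩
    · refine Submodule.span_le.2 ?_ (not_not.1 hw)
      rintro _ ⟨u, hu, rfl⟩
      refine Submodule.span_mono (Set.image_mono ?_) (ih u hu)
      rintro t ⟨ht, rfl | htu⟩
      · exact ⟨ht, Or.inr hu⟩
      · exact ⟨ht, Or.inr (_root_.trans htu hu)⟩

theorem isStrictTotalOrder_shortlex (α : Type*) [LinearOrder α] :
    IsStrictTotalOrder (List α) (List.Shortlex (· < ·)) where
  irrefl a h := Std.Asymm.asymm _ _ h h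
  trans a b c hab hbc := by
    rw [List.shortlex_def] at *
    rcases hab with h | ⟨h, h'⟩ <;> rcases hbc with g | ⟨g, g'⟩
    · exact Or.inl (h.trans g)
    · exact Or.inl (h.trans_eq g)
    · exact Or.inl (h.trans_lt g)
    · exact Or.inr ⟨h.trans g, lt_trans (α := List α) h' g'⟩

/-- A word in the letters `x i` is normal if its value in `A` is not a linear combination of values
of words smaller in the shortlex order. -/
def IsNormalWord (k : Type*) [Field k] {A : Type*} [Ring A] [Algebra k A] {d : ℕ}
    (x : Fin d → A) (w : List (Fin d)) : Prop :=
  IsNormalIndex k (List.Shortlex (· < ·)) (fun w : List (Fin d) => (w.map x).prod) w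

variable {d : ℕ} {x : Fin d → A}

theorem shortlex_append_append_right {α : Type*} {r : α → α → Prop} {s t : List α}
    (h : List.Shortlex r s t) (c : List α) : List.Shortlex r (s ++ c) (t ++ c) := by
  rw [List.shortlex_def] at *
  rcases h with h | ⟨hl, hlex⟩
  · left; simpa using h
  · right
    refine ⟨by simp [hl], ?_⟩
    induction hlex with
    | nil => simp at hl
    | cons _ ih => exact List.Lex.cons (ih (by simpa using hl))
    | rel h => exact List.Lex.rel h

theorem IsNormalWord.of_append {a u b : List (Fin d)} (h : IsNormalWord k x (a ++ u ++ b)) :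
    IsNormalWord k x u := by
  intro hu
  apply h
  let φ : A →ₗ[k] A :=
    (LinearMap.mulRight k (b.map x).prod).comp (LinearMap.mulLeft k (a.map x).prod)
  have hφ : ∀ w : List (Fin d), ((a ++ w ++ b).map x).prod = φ (w.map x).prod := by
    intro w; simp [φ, mul_assoc]
  beta_reduce
  rw [hφ]
  have hmem := Submodule.mem_map_of_mem (f := φ) hu
  rw [Submodule.map_span] at hmem
  refine Submodule.span_mono ?_ hmem
  rintro _ ⟨_, ⟨w, hw, rfl⟩, rfl⟩
  exact ⟨a ++ w ++ b, shortlex_append_append_right (hw.append_left a) b, hφ w⟩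

theorem span_range_pow_eq (h1 : (1 : A) ∈ Submodule.span k (Set.range x)) (n : ℕ) :
    Submodule.span k (Set.range x) ^ n = Submodule.span k
      ((fun w : List (Fin d) => (w.map x).prod) '' {w | IsNormalWord k x w ∧ w.length ≤ n}) := by
  have := isStrictTotalOrder_shortlex (Fin d)
  apply le_antisymm
  · rw [Submodule.span_pow, Submodule.span_le]
    intro a ha
    obtain ⟨g, rfl⟩ := Set.mem_pow.1 ha
    choose i hi using fun j => (g j).2
    have hprod : (List.ofFn fun j => (g j : A)).prod = ((List.ofFn i).map x).prod := by
      simp [List.map_ofFn, Function.comp_def, hi]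
    rw [hprod]
    refine Submodule.span_mono (Set.image_mono ?_)
      (mem_span_isNormalIndex (k := k) (List.Shortlex.wf (wellFounded_lt (α := Fin d)))
        (fun w : List (Fin d) => (w.map x).prod) (List.ofFn i))
    rintro u ⟨hu, rfl | hlt⟩
    · exact ⟨hu, by simp⟩
    · refine ⟨hu, ?_⟩
      rcases List.shortlex_def.1 hlt with h | h
      · simpa using h.le
      · simpa using h.1.le
  · rw [Submodule.span_le]
    rintro _ ⟨w, ⟨-, hw⟩, rfl⟩
    refine pow_le_pow_right₀ (Submodule.one_le.2 h1) hw ?_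
    clear hw
    induction w with
    | nil => exact Submodule.one_le.1 (le_refl (1 : Submodule k A))
    | cons c w ih =>
      beta_reduce
      rw [List.map_cons, List.prod_cons, List.length_cons, pow_succ']
      exact Submodule.mul_mem_mul (Submodule.subset_span ⟨c, rfl⟩) ih

theorem finrank_span_range_pow (h1 : (1 : A) ∈ Submodule.span k (Set.range x)) (n : ℕ) :
    Module.finrank k (Submodule.span k (Set.range x) ^ n : Submodule k A) =
      {w | IsNormalWord k x w ∧ w.length ≤ n}.ncard := by
  have := isStrictTotalOrder_shortlex (Fin d)
  have hfin : {w | IsNormalWord k x w ∧ w.length ≤ n}.Finite :=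
    (List.finite_length_le (Fin d) n).subset fun w hw => hw.2
  have := hfin.fintype
  have hli : LinearIndepOn k (fun w : List (Fin d) => (w.map x).prod)
      {w | IsNormalWord k x w ∧ w.length ≤ n} :=
    (linearIndepOn_isNormalIndex (List.Shortlex (· < ·)) _).mono fun w hw => hw.1
  rw [span_range_pow_eq h1, Set.image_eq_range, finrank_span_eq_card hli,
    ← Nat.card_eq_fintype_card, Nat.card_coe_set_eq]

theorem finrank_span_range_pow_sub (h1 : (1 : A) ∈ Submodule.span k (Set.range x)) {n : ℕ}
    (hn : 1 ≤ n) :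
    Module.finrank k (Submodule.span k (Set.range x) ^ n : Submodule k A) -
        Module.finrank k (Submodule.span k (Set.range x) ^ (n - 1) : Submodule k A) =
      {w | IsNormalWord k x w ∧ w.length = n}.ncard := by
  have hfin : {w | IsNormalWord k x w ∧ w.length ≤ n - 1}.Finite :=
    (List.finite_length_le (Fin d) (n - 1)).subset fun w hw => hw.2
  rw [finrank_span_range_pow h1, finrank_span_range_pow h1, ← Set.ncard_sdiff (hs := hfin)]
  · congr 1
    ext w
    simp only [Set.mem_sdiff, Set.mem_ofPred_eq]
    grind
  · rintro w ⟨hw, hl⟩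
    exact ⟨hw, by lia⟩

theorem ncard_isNormalWord_le_sq {n m : ℕ} (hnm : n ≤ m) (hm : m ≤ 2 * n) :
    {w | IsNormalWord k x w ∧ w.length = m}.ncard ≤
      {w | IsNormalWord k x w ∧ w.length = n}.ncard ^ 2 := by
  have hfin : {w | IsNormalWord k x w ∧ w.length = n}.Finite :=
    (List.finite_length_eq (Fin d) n).subset fun w hw => hw.2
  rw [sq, ← Set.ncard_prod]
  refine Set.ncard_le_ncard_of_injOn (fun w => (w.take n, w.drop (m - n))) ?_ ?_
    (hfin.prod hfin)
  · rintro w ⟨hw, hl⟩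
    refine ⟨⟨?_, by simp; lia⟩, ?_, by simp; lia⟩
    · exact IsNormalWord.of_append (a := []) (b := w.drop n) (by simpa using hw)
    · exact IsNormalWord.of_append (a := w.take (m - n)) (b := []) (by simpa using hw)
  · rintro w ⟨-, hw⟩ u ⟨-, hu⟩ h
    obtain ⟨h₁, h₂⟩ := Prod.mk.inj h
    have h₃ : w.drop n = u.drop n := by
      have := congrArg (List.drop (n - (m - n))) h₂
      simpa [List.drop_drop, show m - n + (n - (m - n)) = n by lia] using this
    rw [← List.take_append_drop n w, ← List.take_append_drop n u, h₁, h₃]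

end NormalWords


/-- Proposition 2.1: for a finitely generated algebra with generating subspace V ∋ 1,
with F(n) = dim V^n (F(0) = 1) and f(n) = F(n) - F(n-1), one has f(m) ≤ f(n)² for
n ≥ 1 and n ≤ m ≤ 2n. -/
theorem algebra_growth_doubling (k : Type*) [Field k] (A : Type*) [Ring A] [Algebra k A]
    (V : Submodule k A) (hVfd : FiniteDimensional k V) (h1V : (1 : A) ∈ V)
    (hgen : Algebra.adjoin k (V : Set A) = ⊤)
    (F f : ℕ → ℕ) (hF0 : F 0 = 1)
    (hF : ∀ n : ℕ, 1 ≤ n → F n = Module.finrank k (V ^ n : Submodule k A))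
    (hf : ∀ n : ℕ, 1 ≤ n → f n = F n - F (n - 1)) :
    ∀ n m : ℕ, 1 ≤ n → n ≤ m → m ≤ 2 * n → f m ≤ f n ^ 2 := by
  intro n m hn hnm hm
  rcases subsingleton_or_nontrivial A with hA | hA
  · have hzero : ∀ j, 1 ≤ j → F j = 0 := fun j hj => by
      rw [hF j hj, Module.finrank_zero_of_subsingleton]
    simp [hf m (hn.trans hnm), hzero m (hn.trans hnm)]
  · obtain ⟨d, x, rfl⟩ : ∃ (d : ℕ) (x : Fin d → A), Submodule.span k (Set.range x) = V :=
      Submodule.fg_iff_exists_fin_generating_family.1 (Module.Finite.iff_fg.1 hVfd)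
    have hF' : ∀ j, F j =
        Module.finrank k (Submodule.span k (Set.range x) ^ j : Submodule k A) := by
      rintro (_ | j)
      · rw [hF0, pow_zero, Submodule.one_eq_span, finrank_span_singleton one_ne_zero]
      · exact hF _ (by lia)
    have hf' : ∀ j, 1 ≤ j → f j = {w | IsNormalWord k x w ∧ w.length = j}.ncard :=
      fun j hj => by rw [hf j hj, hF', hF', finrank_span_range_pow_sub h1V hj]
    rw [hf' n hn, hf' m (hn.trans hnm)]
    exact ncard_isNormalWord_le_sq hnm hm
end
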